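/- Let n ≥ 2 and 0 < ε < 1, and define φ(x) = −log|x| + |x|^ε for x ∈ ℝⁿ ∖ {0}. There exist positive constants R₀, C, C₁, C₂, depending only on n and ε, such that for every W : ℝⁿ → ℝ of class C¹, every δ > 0, every u ∈ C_c^∞(B(0,R₀) ∖ {0}) whose support is contained in {x : |x| ≥ δ}, and every τ ≥ C₁·√(‖W‖_{C¹}) + C₂, one has C·‖ |x|² e^{τφ} (Δu + W u) ‖_{L²} ≥ τ^{3/2}·‖ |x|^{ε/2} e^{τφ} u ‖_{L²} + τ·δ·‖ |x|^{−1} e^{τφ} u ‖_{L²} + τ^{1/2}·‖ |x|^{1+ε/2} e^{τφ} |∇u| ‖_{L²}. -/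

import Mathlib

open MeasureTheory Metric

/-- The Euclidean Laplacian `Δf = Σᵢ ∂²f/∂xᵢ²`. -/
noncomputable def eLap {n : ℕ} (f : EuclideanSpace ℝ (Fin n) → ℝ)
    (x : EuclideanSpace ℝ (Fin n)) : ℝ :=
  ∑ i : Fin n,
    fderiv ℝ (fun y => fderiv ℝ f y (EuclideanSpace.single i 1)) x (EuclideanSpace.single i 1)

/-- The `L²` norm of a function on `ℝⁿ` (with respect to Lebesgue measure). -/
noncomputable def eL2 {n : ℕ} (g : EuclideanSpace ℝ (Fin n) → ℝ) : ℝ :=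
  Real.sqrt (∫ x, (g x) ^ 2)

/-- The `C¹` norm of `W` on the ball `B(0,R₀)`:
`sup_{B(0,R₀)} |W| + sup_{B(0,R₀)} |∇W|`. -/
noncomputable def eC1Norm {n : ℕ} (W : EuclideanSpace ℝ (Fin n) → ℝ) (R₀ : ℝ) : ℝ :=
  sSup ((fun x => |W x|) '' ball (0 : EuclideanSpace ℝ (Fin n)) R₀) +
    sSup ((fun x => ‖gradient W x‖) '' ball (0 : EuclideanSpace ℝ (Fin n)) R₀)


section OffZero

variable {n : ℕ}

/-- A function which is smooth away from the origin and vanishes outside a closed set avoiding the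
origin is smooth. -/
lemma contDiff_of_vanish {K : Set (EuclideanSpace ℝ (Fin n))} (hK : IsClosed K) (h0 : 0 ∉ K)
    {m : WithTop ℕ∞} {h : EuclideanSpace ℝ (Fin n) → ℝ} (hh : ∀ x ≠ 0, ContDiffAt ℝ m h x)
    (hv : ∀ x ∉ K, h x = 0) : ContDiff ℝ m h := by
  rw [contDiff_iff_contDiffAt]
  intro x
  by_cases hx : x = 0
  · subst hx
    have : h =ᶠ[nhds 0] fun _ => 0 := by
      filter_upwards [hK.isOpen_compl.mem_nhds h0] with y hy using hv y hy
    exact contDiffAt_const.congr_of_eventuallyEq this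
  · exact hh x hx

lemma hasCompactSupport_of_vanish {K : Set (EuclideanSpace ℝ (Fin n))} (hK : IsCompact K)
    {h : EuclideanSpace ℝ (Fin n) → ℝ} (hv : ∀ x ∉ K, h x = 0) : HasCompactSupport h :=
  HasCompactSupport.intro hK hv

lemma integrable_of_vanish {K : Set (EuclideanSpace ℝ (Fin n))} (hK : IsCompact K) (h0 : 0 ∉ K)
    {h : EuclideanSpace ℝ (Fin n) → ℝ} (hh : ∀ x ≠ 0, ContinuousAt h x)
    (hv : ∀ x ∉ K, h x = 0) : Integrable h := by
  have hc : Continuous h := by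
    rw [← contDiff_zero (𝕜 := ℝ)]
    have h' : ContinuousOn h {0}ᶜ := fun x hx => (hh x hx).continuousWithinAt
    refine contDiff_of_vanish hK.isClosed h0 (fun x hx => ?_) hv
    have := contDiffOn_zero (𝕜 := ℝ).2 h'
    exact this.contDiffAt (isOpen_compl_singleton.mem_nhds hx)
  exact hc.integrable_of_hasCompactSupport (hasCompactSupport_of_vanish hK hv)

lemma fderiv_eq_zero_of_vanish {K : Set (EuclideanSpace ℝ (Fin n))} (hK : IsClosed K)
    {h : EuclideanSpace ℝ (Fin n) → ℝ} (hv : ∀ x ∉ K, h x = 0)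
    {x : EuclideanSpace ℝ (Fin n)} (hx : x ∉ K) : fderiv ℝ h x = 0 := by
  have : h =ᶠ[nhds x] fun _ => 0 := by
    filter_upwards [hK.isOpen_compl.mem_nhds hx] with y hy using hv y hy
  rw [this.fderiv_eq]
  simp

lemma integral_fderiv_apply_eq_zero {h : EuclideanSpace ℝ (Fin n) → ℝ} (hh : ContDiff ℝ 1 h)
    (hc : HasCompactSupport h) (e : EuclideanSpace ℝ (Fin n)) :
    Integrable (fun x => fderiv ℝ h x e) ∧ ∫ x, fderiv ℝ h x e = 0 := by
  have hi : Integrable (fun x => fderiv ℝ h x e) :=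
    ((hh.continuous_fderiv one_ne_zero).clm_apply continuous_const).integrable_of_hasCompactSupport
      (hc.fderiv_apply (𝕜 := ℝ) e)
  refine ⟨hi, ?_⟩
  have := integral_mul_fderiv_eq_neg_fderiv_mul_of_integrable (𝕜 := ℝ) (μ := volume)
    (f := fun _ : EuclideanSpace ℝ (Fin n) => (1 : ℝ)) (g := h) (v := e) (by simp)
    (by simpa using hi)
    (by simpa using hh.continuous.integrable_of_hasCompactSupport hc)
    (fun x _ => differentiableAt_const _) (fun x _ => hh.differentiable one_ne_zero x)
  simpa using this

lemma hasFDerivAt_norm_rpow_of_ne (p : ℝ) {x : EuclideanSpace ℝ (Fin n)} (hx : x ≠ 0) :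
    HasFDerivAt (fun y : EuclideanSpace ℝ (Fin n) => ‖y‖ ^ p)
      ((p * ‖x‖ ^ p / ‖x‖ ^ 2) • innerSL ℝ x) x := by
  have hpos : 0 < ‖x‖ := norm_pos_iff.2 hx
  have h1 : HasFDerivAt (fun y : EuclideanSpace ℝ (Fin n) => ‖y‖ ^ 2) (2 • innerSL ℝ x) x :=
    (hasStrictFDerivAt_norm_sq x).hasFDerivAt
  have h2 := h1.rpow_const (p := p / 2) (Or.inl (by positivity))
  have h3 : (fun y : EuclideanSpace ℝ (Fin n) => (‖y‖ ^ 2) ^ (p / 2)) = fun y => ‖y‖ ^ p := by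
    ext y
    rw [← Real.rpow_natCast, ← Real.rpow_mul (norm_nonneg _)]
    congr 1
    push_cast
    ring
  rw [h3] at h2
  refine h2.congr_fderiv ?_
  have h4 : (‖x‖ ^ 2) ^ (p / 2 - 1) = ‖x‖ ^ p / ‖x‖ ^ 2 := by
    rw [Real.rpow_sub (by positivity), Real.rpow_one, congrFun h3 x]
  ext y
  rw [h4]
  simp
  ring

lemma contDiffAt_norm_rpow_of_ne {m : WithTop ℕ∞} (p : ℝ) {x : EuclideanSpace ℝ (Fin n)}
    (hx : x ≠ 0) : ContDiffAt ℝ m (fun y : EuclideanSpace ℝ (Fin n) => ‖y‖ ^ p) x :=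
  (contDiffAt_norm ℝ hx).rpow_const_of_ne (norm_pos_iff.2 hx).ne'

lemma hasFDerivAt_norm_sq_apply (x : EuclideanSpace ℝ (Fin n)) :
    HasFDerivAt (fun y : EuclideanSpace ℝ (Fin n) => ‖y‖ ^ 2) ((2 : ℝ) • innerSL ℝ x) x := by
  have := (hasStrictFDerivAt_norm_sq x).hasFDerivAt
  rwa [two_nsmul, ← two_smul ℝ] at this

lemma inner_single_one (x : EuclideanSpace ℝ (Fin n)) (i : Fin n) :
    inner ℝ x (EuclideanSpace.single i (1 : ℝ)) = x i := by
  have h := EuclideanSpace.inner_single_right i (1 : ℝ) x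
  rw [h]
  simp

lemma clm_apply_eq_sum (L : EuclideanSpace ℝ (Fin n) →L[ℝ] ℝ) (x : EuclideanSpace ℝ (Fin n)) :
    L x = ∑ i, x i * L (EuclideanSpace.single i 1) := by
  conv_lhs => rw [← (EuclideanSpace.basisFun (Fin n) ℝ).sum_repr x]
  simp

lemma norm_gradient_sq (u : EuclideanSpace ℝ (Fin n) → ℝ) (x : EuclideanSpace ℝ (Fin n)) :
    ‖gradient u x‖ ^ 2 = ∑ i, (fderiv ℝ u x (EuclideanSpace.single i 1)) ^ 2 := by
  rw [EuclideanSpace.real_norm_sq_eq]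
  refine Finset.sum_congr rfl fun i _ => ?_
  rw [← inner_gradient_left (f := u), inner_single_one]

/-- Divergence of the field `|x|⁻ⁿ G(x) x`. -/
lemma integral_euler_eq_zero {K : Set (EuclideanSpace ℝ (Fin n))} (hK : IsCompact K) (h0 : 0 ∉ K)
    {G : EuclideanSpace ℝ (Fin n) → ℝ} (hG : ∀ x ≠ 0, ContDiffAt ℝ 1 G x)
    (hv : ∀ x ∉ K, G x = 0) :
    Integrable (fun x => ‖x‖ ^ (-(n : ℝ)) * fderiv ℝ G x x) ∧
      ∫ x, ‖x‖ ^ (-(n : ℝ)) * fderiv ℝ G x x = 0 := by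
  have hproj : ∀ (i : Fin n) (x : EuclideanSpace ℝ (Fin n)),
      HasFDerivAt (fun y : EuclideanSpace ℝ (Fin n) => y i) (EuclideanSpace.proj (𝕜 := ℝ) i) x :=
    fun i x => (EuclideanSpace.proj (𝕜 := ℝ) i).hasFDerivAt
  have hX : ∀ i, ContDiff ℝ 1 fun x : EuclideanSpace ℝ (Fin n) =>
      ‖x‖ ^ (-(n : ℝ)) * (x i * G x) := fun i =>
    contDiff_of_vanish hK.isClosed h0 (fun x hx => (contDiffAt_norm_rpow_of_ne _ hx).mul
      (((EuclideanSpace.proj (𝕜 := ℝ) i).contDiff.contDiffAt).mul (hG x hx)))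
      (fun x hx => by simp [hv x hx])
  have hI := fun i => integral_fderiv_apply_eq_zero (hX i)
    (hasCompactSupport_of_vanish hK fun x hx => by simp [hv x hx]) (EuclideanSpace.single i 1)
  have heq : (fun x => ‖x‖ ^ (-(n : ℝ)) * fderiv ℝ G x x) = fun x => ∑ i, fderiv ℝ
      (fun x : EuclideanSpace ℝ (Fin n) => ‖x‖ ^ (-(n : ℝ)) * (x i * G x)) x
      (EuclideanSpace.single i 1) := by
    ext x
    by_cases hxK : x ∈ K
    · have hx : x ≠ 0 := fun h => h0 (h ▸ hxK)
      have hs : ‖x‖ ^ 2 ≠ 0 := by simpa using hx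
      have hd : ∀ i, fderiv ℝ (fun x : EuclideanSpace ℝ (Fin n) =>
          ‖x‖ ^ (-(n : ℝ)) * (x i * G x)) x (EuclideanSpace.single i 1) =
          ‖x‖ ^ (-(n : ℝ)) * (x i * fderiv ℝ G x (EuclideanSpace.single i 1))
          + ‖x‖ ^ (-(n : ℝ)) * G x * 1 - n * ‖x‖ ^ (-(n : ℝ)) * G x / ‖x‖ ^ 2 * x i ^ 2 := by
        intro i
        rw [((hasFDerivAt_norm_rpow_of_ne (-(n : ℝ)) hx).fun_mul ((hproj i x).fun_mul
          ((hG x hx).differentiableAt one_ne_zero).hasFDerivAt)).fderiv]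
        simp [inner_single_one]
        ring
      simp_rw [hd]
      rw [Finset.sum_sub_distrib, Finset.sum_add_distrib, ← Finset.mul_sum, ← Finset.mul_sum,
        ← Finset.mul_sum, ← EuclideanSpace.real_norm_sq_eq, ← clm_apply_eq_sum]
      simp
      field_simp
      ring
    · rw [fderiv_eq_zero_of_vanish hK.isClosed hv hxK]
      simp_rw [fun i => fderiv_eq_zero_of_vanish hK.isClosed (x := x)
        (h := fun x : EuclideanSpace ℝ (Fin n) => ‖x‖ ^ (-(n : ℝ)) * (x i * G x))
        (fun x hx => by simp [hv x hx]) hxK]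
      simp
  rw [heq]
  refine ⟨integrable_finsetSum _ fun i _ => (hI i).1, ?_⟩
  rw [integral_finsetSum _ fun i _ => (hI i).1]
  exact Finset.sum_eq_zero fun i _ => (hI i).2

/-- Divergence of the field `|x|²⁻ⁿ w ∇v`. -/
lemma integral_green_eq_zero {K : Set (EuclideanSpace ℝ (Fin n))} (hK : IsCompact K) (h0 : 0 ∉ K)
    {v w : EuclideanSpace ℝ (Fin n) → ℝ} (hv2 : ContDiff ℝ 2 v) (hw1 : ContDiff ℝ 1 w)
    (hw : ∀ x ∉ K, w x = 0) :
    Integrable (fun x => ‖x‖ ^ (-(n : ℝ)) * (w x * (‖x‖ ^ 2 * eLap v x - (n - 2) * fderiv ℝ v x x)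
        + ‖x‖ ^ 2 * ∑ i, fderiv ℝ v x (EuclideanSpace.single i 1) *
          fderiv ℝ w x (EuclideanSpace.single i 1))) ∧
      ∫ x, ‖x‖ ^ (-(n : ℝ)) * (w x * (‖x‖ ^ 2 * eLap v x - (n - 2) * fderiv ℝ v x x)
        + ‖x‖ ^ 2 * ∑ i, fderiv ℝ v x (EuclideanSpace.single i 1) *
          fderiv ℝ w x (EuclideanSpace.single i 1)) = 0 := by
  set p : Fin n → EuclideanSpace ℝ (Fin n) → ℝ :=
    fun i y => fderiv ℝ v y (EuclideanSpace.single i 1) with hp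
  have hp1 : ∀ i, ContDiff ℝ 1 (p i) := fun i =>
    (hv2.fderiv_right (m := 1) (by norm_num)).clm_apply contDiff_const
  have hX : ∀ i, ContDiff ℝ 1 fun x : EuclideanSpace ℝ (Fin n) =>
      ‖x‖ ^ (2 - n : ℝ) * (w x * p i x) := fun i =>
    contDiff_of_vanish hK.isClosed h0 (fun x hx => (contDiffAt_norm_rpow_of_ne _ hx).mul
      (hw1.contDiffAt.mul (hp1 i).contDiffAt)) (fun x hx => by simp [hw x hx])
  have hI := fun i => integral_fderiv_apply_eq_zero (hX i)
    (hasCompactSupport_of_vanish hK fun x hx => by simp [hw x hx]) (EuclideanSpace.single i 1)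
  have heq : (fun x => ‖x‖ ^ (-(n : ℝ)) * (w x * (‖x‖ ^ 2 * eLap v x - (n - 2) * fderiv ℝ v x x)
        + ‖x‖ ^ 2 * ∑ i, fderiv ℝ v x (EuclideanSpace.single i 1) *
          fderiv ℝ w x (EuclideanSpace.single i 1))) = fun x => ∑ i, fderiv ℝ
      (fun x : EuclideanSpace ℝ (Fin n) => ‖x‖ ^ (2 - n : ℝ) * (w x * p i x)) x
      (EuclideanSpace.single i 1) := by
    ext x
    by_cases hxK : x ∈ K
    · have hx : x ≠ 0 := fun h => h0 (h ▸ hxK)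
      have hs : ‖x‖ ^ 2 ≠ 0 := by simpa using hx
      have hM : ‖x‖ ^ (2 - n : ℝ) = ‖x‖ ^ 2 * ‖x‖ ^ (-(n : ℝ)) := by
        rw [sub_eq_add_neg, Real.rpow_add (norm_pos_iff.2 hx)]
        norm_cast
      have hd : ∀ i, fderiv ℝ (fun x : EuclideanSpace ℝ (Fin n) =>
          ‖x‖ ^ (2 - n : ℝ) * (w x * p i x)) x (EuclideanSpace.single i 1) =
          ‖x‖ ^ 2 * ‖x‖ ^ (-(n : ℝ)) * w x *
            fderiv ℝ (p i) x (EuclideanSpace.single i 1)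
          + ‖x‖ ^ 2 * ‖x‖ ^ (-(n : ℝ)) * (fderiv ℝ v x (EuclideanSpace.single i 1) *
            fderiv ℝ w x (EuclideanSpace.single i 1))
          + (2 - n) * ‖x‖ ^ (-(n : ℝ)) * w x *
            (x i * fderiv ℝ v x (EuclideanSpace.single i 1)) := by
        intro i
        rw [((hasFDerivAt_norm_rpow_of_ne (2 - n : ℝ) hx).fun_mul
          ((hw1.differentiable one_ne_zero x).hasFDerivAt.fun_mul
          ((hp1 i).differentiable one_ne_zero x).hasFDerivAt)).fderiv]
        simp [hM, hp, inner_single_one]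
        field_simp
      simp_rw [hd]
      rw [Finset.sum_add_distrib, Finset.sum_add_distrib, ← Finset.mul_sum, ← Finset.mul_sum,
        ← Finset.mul_sum, ← clm_apply_eq_sum]
      simp only [eLap, hp]
      ring
    · rw [fderiv_eq_zero_of_vanish hK.isClosed hw hxK, hw x hxK]
      simp_rw [fun i => fderiv_eq_zero_of_vanish hK.isClosed (x := x)
        (h := fun x : EuclideanSpace ℝ (Fin n) => ‖x‖ ^ (2 - n : ℝ) * (w x * p i x))
        (fun x hx => by simp [hw x hx]) hxK]
      simp
  rw [heq]
  refine ⟨integrable_finsetSum _ fun i _ => (hI i).1, ?_⟩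
  rw [integral_finsetSum _ fun i _ => (hI i).1]
  exact Finset.sum_eq_zero fun i _ => (hI i).2

end OffZero

section Conjugation

variable {n : ℕ}

/-- The factor `|x|^{n/2} e^{τφ(x)}`. -/
noncomputable def carlemanFactor (n : ℕ) (ε τ : ℝ) (x : EuclideanSpace ℝ (Fin n)) : ℝ :=
  ‖x‖ ^ ((n : ℝ) / 2 - τ) * Real.exp (τ * ‖x‖ ^ ε)

lemma contDiffAt_carlemanFactor {m : WithTop ℕ∞} (ε τ : ℝ) {x : EuclideanSpace ℝ (Fin n)}
    (hx : x ≠ 0) : ContDiffAt ℝ m (carlemanFactor n ε τ) x :=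
  (contDiffAt_norm_rpow_of_ne _ hx).mul
    (contDiffAt_const.mul (contDiffAt_norm_rpow_of_ne _ hx)).exp

lemma hasFDerivAt_carlemanFactor (ε τ : ℝ) {x : EuclideanSpace ℝ (Fin n)} (hx : x ≠ 0) :
    HasFDerivAt (carlemanFactor n ε τ)
      ((carlemanFactor n ε τ x * (n / 2 - τ + τ * ε * ‖x‖ ^ ε) / ‖x‖ ^ 2) • innerSL ℝ x) x := by
  have h := (hasFDerivAt_norm_rpow_of_ne ((n : ℝ) / 2 - τ) hx).fun_mul
    ((hasFDerivAt_norm_rpow_of_ne ε hx).const_mul τ).exp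
  refine h.congr_fderiv ?_
  ext y
  simp [carlemanFactor]
  ring

lemma fderiv_carlemanFactor_mul (ε τ : ℝ) {u : EuclideanSpace ℝ (Fin n) → ℝ}
    (hu : Differentiable ℝ u) {x : EuclideanSpace ℝ (Fin n)} (hx : x ≠ 0)
    (e : EuclideanSpace ℝ (Fin n)) :
    fderiv ℝ (fun y => carlemanFactor n ε τ y * u y) x e =
      carlemanFactor n ε τ x *
        ((n / 2 - τ + τ * ε * ‖x‖ ^ ε) / ‖x‖ ^ 2 * inner ℝ x e * u x + fderiv ℝ u x e) := by
  rw [((hasFDerivAt_carlemanFactor ε τ hx).fun_mul (hu x).hasFDerivAt).fderiv]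
  simp
  ring

lemma carlemanFactor_mul_eLap (ε τ : ℝ) {u : EuclideanSpace ℝ (Fin n) → ℝ}
    (hu : ContDiff ℝ 2 u) {x : EuclideanSpace ℝ (Fin n)} (hx : x ≠ 0) :
    carlemanFactor n ε τ x * (‖x‖ ^ 2 * eLap u x) =
      ‖x‖ ^ 2 * eLap (fun y => carlemanFactor n ε τ y * u y) x
      - (n - 2) * fderiv ℝ (fun y => carlemanFactor n ε τ y * u y) x x
      + 2 * (τ - τ * ε * ‖x‖ ^ ε - 1) * fderiv ℝ (fun y => carlemanFactor n ε τ y * u y) x x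
      + ((τ - τ * ε * ‖x‖ ^ ε - 1) ^ 2 - (((n : ℝ) - 2) / 2) ^ 2 - τ * ε ^ 2 * ‖x‖ ^ ε) *
        (carlemanFactor n ε τ x * u x) := by
  have hud : Differentiable ℝ u := hu.differentiable two_ne_zero
  have hs : ‖x‖ ≠ 0 := by simpa using hx
  set p : Fin n → EuclideanSpace ℝ (Fin n) → ℝ :=
    fun i y => fderiv ℝ u y (EuclideanSpace.single i 1) with hp
  have hp1 : ∀ i, Differentiable ℝ (p i) := fun i =>
    ((hu.fderiv_right (m := 1) (by norm_num)).clm_apply contDiff_const).differentiable one_ne_zero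
  have hproj : ∀ (i : Fin n) (x : EuclideanSpace ℝ (Fin n)),
      HasFDerivAt (fun y : EuclideanSpace ℝ (Fin n) => y i) (EuclideanSpace.proj (𝕜 := ℝ) i) x :=
    fun i x => (EuclideanSpace.proj (𝕜 := ℝ) i).hasFDerivAt
  have hd : ∀ i, fderiv ℝ (fun y => fderiv ℝ (fun y => carlemanFactor n ε τ y * u y) y
      (EuclideanSpace.single i 1)) x (EuclideanSpace.single i 1) =
      carlemanFactor n ε τ x * u x / ‖x‖ ^ 2 / ‖x‖ ^ 2 *
        ((n / 2 - τ + τ * ε * ‖x‖ ^ ε) ^ 2 + τ * ε ^ 2 * ‖x‖ ^ ε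
          - 2 * (n / 2 - τ + τ * ε * ‖x‖ ^ ε)) * x i ^ 2
      + carlemanFactor n ε τ x * 2 * (n / 2 - τ + τ * ε * ‖x‖ ^ ε) / ‖x‖ ^ 2 *
        (x i * fderiv ℝ u x (EuclideanSpace.single i 1))
      + carlemanFactor n ε τ x * u x * (n / 2 - τ + τ * ε * ‖x‖ ^ ε) / ‖x‖ ^ 2 * 1
      + carlemanFactor n ε τ x * fderiv ℝ (p i) x (EuclideanSpace.single i 1) := by
    intro i
    have hev : (fun y => fderiv ℝ (fun y => carlemanFactor n ε τ y * u y) y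
        (EuclideanSpace.single i 1)) =ᶠ[nhds x] fun y => carlemanFactor n ε τ y *
          ((n / 2 - τ + τ * ε * ‖y‖ ^ ε) * ‖y‖ ^ (-2 : ℝ) * y i * u y + p i y) := by
      filter_upwards [isOpen_compl_singleton.mem_nhds hx] with y hy
      rw [fderiv_carlemanFactor_mul ε τ hud hy, inner_single_one, Real.rpow_neg (norm_nonneg _)]
      norm_cast
    rw [hev.fderiv_eq, ((hasFDerivAt_carlemanFactor ε τ hx).fun_mul
      (((((((hasFDerivAt_norm_rpow_of_ne ε hx).const_mul (τ * ε)).const_add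
        ((n : ℝ) / 2 - τ)).fun_mul (hasFDerivAt_norm_rpow_of_ne (-2) hx)).fun_mul
        (hproj i x)).fun_mul (hud x).hasFDerivAt).fun_add (hp1 i x).hasFDerivAt)).fderiv]
    have h2 : ‖x‖ ^ (-2 : ℝ) = 1 / ‖x‖ ^ 2 := by
      rw [Real.rpow_neg (norm_nonneg _), one_div]
      norm_cast
    simp [inner_single_one, h2, hp]
    field_simp
    ring
  have hxs : fderiv ℝ u x x = ∑ i, x i * fderiv ℝ u x (EuclideanSpace.single i 1) :=
    clm_apply_eq_sum _ x
  rw [fderiv_carlemanFactor_mul ε τ hud hx, real_inner_self_eq_norm_sq]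
  simp only [eLap]
  simp_rw [hd]
  rw [Finset.sum_add_distrib, Finset.sum_add_distrib, Finset.sum_add_distrib, ← Finset.mul_sum,
    ← Finset.mul_sum, ← Finset.mul_sum, ← Finset.mul_sum, ← EuclideanSpace.real_norm_sq_eq, ← hxs]
  simp only [Finset.sum_const, Finset.card_univ, Fintype.card_fin, nsmul_eq_mul, mul_one]
  field_simp
  ring

end Conjugation

section Multipliers

variable {n : ℕ}

/-- The antisymmetric part of the conjugated operator, applied to `v`. -/
noncomputable def carlemanMultiplier (ε τ : ℝ) (v : EuclideanSpace ℝ (Fin n) → ℝ)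
    (x : EuclideanSpace ℝ (Fin n)) : ℝ :=
  2 * (τ - τ * ε * ‖x‖ ^ ε - 1) * fderiv ℝ v x x - τ * ε ^ 2 * ‖x‖ ^ ε * v x

/-- The density whose Euler derivative appears in the commutator computation. -/
noncomputable def carlemanFlux (ε τ : ℝ) (v W : EuclideanSpace ℝ (Fin n) → ℝ)
    (x : EuclideanSpace ℝ (Fin n)) : ℝ :=
  (τ - τ * ε * ‖x‖ ^ ε - 1) * (((τ - τ * ε * ‖x‖ ^ ε - 1) ^ 2 - (((n : ℝ) - 2) / 2) ^ 2
      + ‖x‖ ^ 2 * W x) * v x ^ 2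
    - ‖x‖ ^ 2 * ∑ i, fderiv ℝ v x (EuclideanSpace.single i 1) ^ 2)
  + τ * ε ^ 3 / 2 * ‖x‖ ^ ε * v x ^ 2

lemma hasFDerivAt_fderiv_self {v : EuclideanSpace ℝ (Fin n) → ℝ} (hv : ContDiff ℝ 2 v)
    (x : EuclideanSpace ℝ (Fin n)) :
    HasFDerivAt (fun y => fderiv ℝ v y y) (fderiv ℝ v x + fderiv ℝ (fderiv ℝ v) x x) x := by
  have h1 : HasFDerivAt (fderiv ℝ v) (fderiv ℝ (fderiv ℝ v) x) x :=
    ((hv.fderiv_right (m := 1) (by norm_num)).differentiable one_ne_zero x).hasFDerivAt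
  refine (h1.clm_apply (hasFDerivAt_id x)).congr_fderiv ?_
  ext e
  have hsym : IsSymmSndFDerivAt ℝ v x := hv.contDiffAt.isSymmSndFDerivAt (by simp)
  simp [hsym.eq e x]

lemma sum_fderiv_mul_fderiv_carlemanMultiplier (ε τ : ℝ) {v : EuclideanSpace ℝ (Fin n) → ℝ}
    (hv : ContDiff ℝ 2 v) {x : EuclideanSpace ℝ (Fin n)} (hx : x ≠ 0) :
    ‖x‖ ^ 2 * ∑ i, fderiv ℝ v x (EuclideanSpace.single i 1) *
        fderiv ℝ (carlemanMultiplier ε τ v) x (EuclideanSpace.single i 1) =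
      -2 * τ * ε ^ 2 * ‖x‖ ^ ε * fderiv ℝ v x x ^ 2
      - τ * ε ^ 3 * ‖x‖ ^ ε * v x * fderiv ℝ v x x
      + (2 * (τ - τ * ε * ‖x‖ ^ ε - 1) - τ * ε ^ 2 * ‖x‖ ^ ε) *
        (‖x‖ ^ 2 * ∑ i, fderiv ℝ v x (EuclideanSpace.single i 1) ^ 2)
      + 2 * (τ - τ * ε * ‖x‖ ^ ε - 1) * (‖x‖ ^ 2 * ∑ i,
        fderiv ℝ v x (EuclideanSpace.single i 1) *
          fderiv ℝ (fderiv ℝ v) x x (EuclideanSpace.single i 1)) := by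
  have hs : ‖x‖ ≠ 0 := by simpa using hx
  have hd : ∀ i, fderiv ℝ v x (EuclideanSpace.single i 1) *
        fderiv ℝ (carlemanMultiplier ε τ v) x (EuclideanSpace.single i 1) =
      (-2 * τ * ε ^ 2 * ‖x‖ ^ ε * fderiv ℝ v x x - τ * ε ^ 3 * ‖x‖ ^ ε * v x) / ‖x‖ ^ 2 *
        (x i * fderiv ℝ v x (EuclideanSpace.single i 1))
      + (2 * (τ - τ * ε * ‖x‖ ^ ε - 1) - τ * ε ^ 2 * ‖x‖ ^ ε) *
        fderiv ℝ v x (EuclideanSpace.single i 1) ^ 2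
      + 2 * (τ - τ * ε * ‖x‖ ^ ε - 1) * (fderiv ℝ v x (EuclideanSpace.single i 1) *
          fderiv ℝ (fderiv ℝ v) x x (EuclideanSpace.single i 1)) := by
    intro i
    have hρ := (hasFDerivAt_norm_rpow_of_ne ε hx)
    have h : HasFDerivAt (carlemanMultiplier ε τ v) _ x :=
      (((((hρ.const_mul (τ * ε)).const_sub τ).sub_const 1).const_mul 2).fun_mul
      (hasFDerivAt_fderiv_self hv x)).fun_sub ((hρ.const_mul (τ * ε ^ 2)).fun_mul
      (hv.differentiable two_ne_zero x).hasFDerivAt)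
    rw [h.fderiv]
    simp [inner_single_one]
    field_simp
    ring
  simp_rw [hd]
  rw [Finset.sum_add_distrib, Finset.sum_add_distrib, ← Finset.mul_sum, ← Finset.mul_sum,
    ← Finset.mul_sum, ← clm_apply_eq_sum]
  field_simp

lemma sum_fderiv_mul_fderiv_norm_rpow_mul (ε : ℝ) {v : EuclideanSpace ℝ (Fin n) → ℝ}
    (hv : ContDiff ℝ 2 v) {x : EuclideanSpace ℝ (Fin n)} (hx : x ≠ 0) :
    ‖x‖ ^ 2 * ∑ i, fderiv ℝ v x (EuclideanSpace.single i 1) *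
        fderiv ℝ (fun y => ‖y‖ ^ ε * v y) x (EuclideanSpace.single i 1) =
      ε * ‖x‖ ^ ε * v x * fderiv ℝ v x x
      + ‖x‖ ^ ε * (‖x‖ ^ 2 * ∑ i, fderiv ℝ v x (EuclideanSpace.single i 1) ^ 2) := by
  have hs : ‖x‖ ≠ 0 := by simpa using hx
  have hd : ∀ i, fderiv ℝ v x (EuclideanSpace.single i 1) *
        fderiv ℝ (fun y => ‖y‖ ^ ε * v y) x (EuclideanSpace.single i 1) =
      ε * ‖x‖ ^ ε * v x / ‖x‖ ^ 2 * (x i * fderiv ℝ v x (EuclideanSpace.single i 1))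
      + ‖x‖ ^ ε * fderiv ℝ v x (EuclideanSpace.single i 1) ^ 2 := by
    intro i
    rw [((hasFDerivAt_norm_rpow_of_ne ε hx).fun_mul
      (hv.differentiable two_ne_zero x).hasFDerivAt).fderiv]
    simp [inner_single_one]
    field_simp
    ring
  simp_rw [hd]
  rw [Finset.sum_add_distrib, ← Finset.mul_sum, ← Finset.mul_sum, ← clm_apply_eq_sum]
  field_simp

lemma fderiv_carlemanFlux_self (ε τ : ℝ) {v W : EuclideanSpace ℝ (Fin n) → ℝ}
    (hv : ContDiff ℝ 2 v) (hW : ContDiff ℝ 1 W) {x : EuclideanSpace ℝ (Fin n)} (hx : x ≠ 0) :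
    fderiv ℝ (carlemanFlux ε τ v W) x x =
      -τ * ε ^ 2 * ‖x‖ ^ ε * (((τ - τ * ε * ‖x‖ ^ ε - 1) ^ 2 - (((n : ℝ) - 2) / 2) ^ 2
        + ‖x‖ ^ 2 * W x) * v x ^ 2
        - ‖x‖ ^ 2 * ∑ i, fderiv ℝ v x (EuclideanSpace.single i 1) ^ 2)
      + (τ - τ * ε * ‖x‖ ^ ε - 1) * (
        (-2 * (τ - τ * ε * ‖x‖ ^ ε - 1) * (τ * ε ^ 2 * ‖x‖ ^ ε) + 2 * ‖x‖ ^ 2 * W x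
          + ‖x‖ ^ 2 * fderiv ℝ W x x) * v x ^ 2
        + ((τ - τ * ε * ‖x‖ ^ ε - 1) ^ 2 - (((n : ℝ) - 2) / 2) ^ 2 + ‖x‖ ^ 2 * W x) *
          (2 * v x * fderiv ℝ v x x)
        - 2 * (‖x‖ ^ 2 * ∑ i, fderiv ℝ v x (EuclideanSpace.single i 1) ^ 2)
        - 2 * (‖x‖ ^ 2 * ∑ i, fderiv ℝ v x (EuclideanSpace.single i 1) *
          fderiv ℝ (fderiv ℝ v) x x (EuclideanSpace.single i 1)))
      + τ * ε ^ 4 / 2 * ‖x‖ ^ ε * v x ^ 2 + τ * ε ^ 3 * ‖x‖ ^ ε * v x * fderiv ℝ v x x := by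
  have hs : ‖x‖ ≠ 0 := by simpa using hx
  have hρ := (hasFDerivAt_norm_rpow_of_ne ε hx)
  have hvx := (hv.differentiable two_ne_zero x).hasFDerivAt
  have hWx := (hW.differentiable one_ne_zero x).hasFDerivAt
  have hβ := ((hρ.const_mul (τ * ε)).const_sub τ).sub_const 1
  have hn := hasFDerivAt_norm_sq_apply x
  have h1 : HasFDerivAt (fderiv ℝ v) (fderiv ℝ (fderiv ℝ v) x) x :=
    ((hv.fderiv_right (m := 1) (by norm_num)).differentiable one_ne_zero x).hasFDerivAt
  have hp : ∀ i ∈ Finset.univ, HasFDerivAt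
      (fun y => fderiv ℝ v y (EuclideanSpace.single i 1) ^ 2) _ x := fun i _ =>
    (h1.clm_apply (hasFDerivAt_const (EuclideanSpace.single i 1) x)).pow 2
  have hP := HasFDerivAt.fun_sum hp
  have h : HasFDerivAt (carlemanFlux ε τ v W) _ x :=
    (hβ.fun_mul (((((hβ.pow 2).sub_const ((((n : ℝ) - 2) / 2) ^ 2)).fun_add
      (hn.fun_mul hWx)).fun_mul (hvx.pow 2)).fun_sub (hn.fun_mul hP))).fun_add
    ((hρ.const_mul (τ * ε ^ 3 / 2)).fun_mul (hvx.pow 2))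
  rw [h.fderiv]
  have hQ : ∑ i, 2 * fderiv ℝ v x (EuclideanSpace.single i 1) *
          fderiv ℝ (fderiv ℝ v) x x (EuclideanSpace.single i 1) =
      2 * ∑ i, fderiv ℝ v x (EuclideanSpace.single i 1) *
          fderiv ℝ (fderiv ℝ v) x x (EuclideanSpace.single i 1) := by
    rw [Finset.mul_sum]
    exact Finset.sum_congr rfl fun i _ => by ring
  simp [hQ]
  field_simp
  ring

lemma fderiv_norm_rpow_mul_sq_self (p : ℝ) {v : EuclideanSpace ℝ (Fin n) → ℝ}
    (hv : ContDiff ℝ 2 v) {x : EuclideanSpace ℝ (Fin n)} (hx : x ≠ 0) :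
    fderiv ℝ (fun y => ‖y‖ ^ p * v y ^ 2) x x =
      p * ‖x‖ ^ p * v x ^ 2 + 2 * ‖x‖ ^ p * v x * fderiv ℝ v x x := by
  have hs : ‖x‖ ≠ 0 := by simpa using hx
  rw [((hasFDerivAt_norm_rpow_of_ne p hx).fun_mul
      ((hv.differentiable two_ne_zero x).hasFDerivAt.pow 2)).fderiv]
  simp
  field_simp
  ring

end Multipliers

section Pointwise

variable {n : ℕ}

/-- Positivity of the commutator, as an inequality between the values at one point. -/
lemma commutator_lower_bound {c ε τ ρ s v d g q l W D N f : ℝ} (hε0 : 0 < ε) (hε1 : ε < 1)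
    (hτ : 4 ≤ τ) (hρ0 : 0 ≤ ρ) (hρ : ρ ≤ 1 / 2) (hs0 : 0 ≤ s) (hs : s ≤ ρ) (hW : |W| ≤ N)
    (hD : |D| ≤ N) (hN : N ≤ ε ^ 2 * τ ^ 2 / 100)
    (hf : f = l + 2 * (τ - τ * ε * ρ - 1) * d
      + ((τ - τ * ε * ρ - 1) ^ 2 - c ^ 2 - τ * ε ^ 2 * ρ + s * W) * v) :
    (2 * (τ - τ * ε * ρ - 1) * d - τ * ε ^ 2 * ρ * v) ^ 2 / 2 + 2 * (τ * ε ^ 2 * ρ * d ^ 2)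
      + ε ^ 2 / 16 * (τ ^ 3 * ρ * v ^ 2) ≤
    f ^ 2 / 2 - ((2 * (τ - τ * ε * ρ - 1) * d - τ * ε ^ 2 * ρ * v) * l
      + (-2 * τ * ε ^ 2 * ρ * d ^ 2 - τ * ε ^ 3 * ρ * v * d
        + (2 * (τ - τ * ε * ρ - 1) - τ * ε ^ 2 * ρ) * g + 2 * (τ - τ * ε * ρ - 1) * q)
      + (-τ * ε ^ 2 * ρ * (((τ - τ * ε * ρ - 1) ^ 2 - c ^ 2 + s * W) * v ^ 2 - g)
        + (τ - τ * ε * ρ - 1) * (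
          (-2 * (τ - τ * ε * ρ - 1) * (τ * ε ^ 2 * ρ) + 2 * s * W + s * D) * v ^ 2
          + ((τ - τ * ε * ρ - 1) ^ 2 - c ^ 2 + s * W) * (2 * v * d) - 2 * g - 2 * q)
        + τ * ε ^ 4 / 2 * ρ * v ^ 2 + τ * ε ^ 3 * ρ * v * d)) := by
  have hερ : ε * ρ ≤ 1 / 2 := by nlinarith
  have hερ0 : 0 ≤ ε * ρ := by positivity
  set β : ℝ := τ - τ * ε * ρ - 1 with hβ
  have hβ1 : τ / 4 ≤ β := by nlinarith
  have hβ2 : β ≤ τ := by nlinarith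
  have hβsq : τ ^ 2 / 16 ≤ β ^ 2 := by nlinarith
  have h1 : ε ^ 2 * (τ ^ 3 * ρ) / 8 ≤ 2 * (τ * ε ^ 2 * ρ) * β ^ 2 := by
    have := mul_le_mul_of_nonneg_left hβsq (by positivity : 0 ≤ 2 * (τ * ε ^ 2 * ρ))
    linarith
  have h2 : τ * ε ^ 4 / 2 * ρ ≤ ε ^ 2 * (τ ^ 3 * ρ) / 32 := by
    have a1 : ε ^ 2 ≤ 1 := by nlinarith
    have a2 : 16 ≤ τ ^ 2 := by nlinarith
    have := mul_le_mul_of_nonneg_left (a1.trans (by linarith : 1 ≤ τ ^ 2 / 16))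
      (by positivity : 0 ≤ τ * ε ^ 2 * ρ / 2)
    linarith
  have h3 : β * (2 * s * W + s * D) ≤ 3 * (ε ^ 2 * (τ ^ 3 * ρ)) / 100 := by
    have hN0 : 0 ≤ N := (abs_nonneg _).trans hW
    have a1 : 2 * W + D ≤ 3 * N := by linarith [le_abs_self W, le_abs_self D]
    calc β * (2 * s * W + s * D) = β * s * (2 * W + D) := by ring
      _ ≤ β * s * (3 * N) := mul_le_mul_of_nonneg_left a1 (mul_nonneg (by linarith) hs0)
      _ ≤ τ * ρ * (3 * (ε ^ 2 * τ ^ 2 / 100)) := by gcongr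
      _ = _ := by ring
  have h4 : 0 ≤ ε ^ 2 * (τ ^ 3 * ρ) := by positivity
  have key : ε ^ 2 / 16 * (τ ^ 3 * ρ) ≤ 2 * (τ * ε ^ 2 * ρ) * β ^ 2 - τ * ε ^ 4 / 2 * ρ
      - β * (2 * s * W + s * D) := by linarith
  have key2 := mul_le_mul_of_nonneg_right key (sq_nonneg v)
  have hsq := sq_nonneg (f - (2 * β * d - τ * ε ^ 2 * ρ * v))
  have hl : l = f - 2 * β * d - (β ^ 2 - c ^ 2 - τ * ε ^ 2 * ρ + s * W) * v := by
    rw [hf]; ring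
  clear_value β
  subst hl
  nlinarith only [key2, hsq]

lemma angular_upper_bound {c ε τ ρ s v d g l W N f : ℝ} (hε0 : 0 < ε) (hε1 : ε < 1)
    (hτ : 4 ≤ τ) (hρ0 : 0 ≤ ρ) (hρ : ρ ≤ 1 / 2) (hs0 : 0 ≤ s) (hs : s ≤ ρ) (hW : |W| ≤ N)
    (hN : N ≤ ε ^ 2 * τ ^ 2 / 100)
    (hf : f = l + 2 * (τ - τ * ε * ρ - 1) * d
      + ((τ - τ * ε * ρ - 1) ^ 2 - c ^ 2 - τ * ε ^ 2 * ρ + s * W) * v) :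
    τ * ρ * g ≤ τ * (ρ * v * l + (ε * ρ * v * d + ρ * g)) + f ^ 2 / 2 + 4 * (τ ^ 3 * ρ * v ^ 2)
      + 2 * (τ * ρ * d ^ 2) := by
  have hερ : ε * ρ ≤ 1 / 2 := by nlinarith
  have hερ0 : 0 ≤ ε * ρ := by positivity
  set β : ℝ := τ - τ * ε * ρ - 1 with hβ
  have hβ1 : τ / 4 ≤ β := by nlinarith
  have hβ2 : β ≤ τ := by nlinarith
  have hβsq : β ^ 2 ≤ τ ^ 2 := by nlinarith
  have hsW : s * W ≤ τ ^ 2 / 2 := by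
    have a1 : W ≤ τ ^ 2 / 100 := by
      have : ε ^ 2 ≤ 1 := by nlinarith
      nlinarith [le_abs_self W, sq_nonneg τ]
    nlinarith [sq_nonneg τ]
  have hV : β ^ 2 - c ^ 2 - τ * ε ^ 2 * ρ + s * W ≤ 3 / 2 * τ ^ 2 := by
    have : 0 ≤ τ * ε ^ 2 * ρ := by positivity
    nlinarith [sq_nonneg c]
  have h1 : τ * ρ * (β ^ 2 - c ^ 2 - τ * ε ^ 2 * ρ + s * W) * v ^ 2 ≤
      3 / 2 * (τ ^ 3 * ρ * v ^ 2) := by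
    have := mul_le_mul_of_nonneg_left hV (by positivity : 0 ≤ τ * ρ * v ^ 2)
    linarith
  have h2 : -(τ * ρ * v * f) ≤ f ^ 2 / 2 + τ ^ 3 * ρ * v ^ 2 / 2 := by
    have a1 : τ ^ 2 * ρ ^ 2 * v ^ 2 ≤ τ ^ 3 * ρ * v ^ 2 := by
      have : τ ^ 2 * ρ ^ 2 ≤ τ ^ 3 * ρ := by
        have : ρ ≤ τ := by linarith
        have := mul_le_mul_of_nonneg_left this (by positivity : 0 ≤ τ ^ 2 * ρ)
        linarith
      gcongr
    linarith [sq_nonneg (f + τ * ρ * v)]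
  have h3 : 2 * (τ * ρ * β) * (v * d) ≤ τ ^ 3 * ρ * v ^ 2 + τ * ρ * d ^ 2 := by
    have a1 := mul_nonneg (by positivity : 0 ≤ τ * ρ) (sq_nonneg (β * v - d))
    have a2 := mul_le_mul_of_nonneg_left hβsq (by positivity : 0 ≤ τ * ρ * v ^ 2)
    linarith
  have h4 : -(τ * ε * ρ * (v * d)) ≤ τ ^ 3 * ρ * v ^ 2 + τ * ρ * d ^ 2 := by
    have a1 := mul_nonneg (by positivity : 0 ≤ τ * ρ) (sq_nonneg (ε * v + d))
    have a2 : ε ^ 2 ≤ τ ^ 2 := by nlinarith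
    have a3 := mul_le_mul_of_nonneg_left a2 (by positivity : 0 ≤ τ * ρ * v ^ 2)
    have a4 : 0 ≤ τ * ρ * d ^ 2 := by positivity
    have a5 : 0 ≤ τ ^ 3 * ρ * v ^ 2 := by positivity
    linarith
  have h5 : 0 ≤ τ ^ 3 * ρ * v ^ 2 := by positivity
  have hl : l = f - 2 * β * d - (β ^ 2 - c ^ 2 - τ * ε ^ 2 * ρ + s * W) * v := by
    rw [hf]; ring
  clear_value β
  subst hl
  linarith

lemma radial_upper_bound {ε τ ρ v d : ℝ} (hε0 : 0 < ε) (hε1 : ε < 1)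
    (hτ : 4 ≤ τ) (hρ0 : 0 ≤ ρ) (hρ : ρ ≤ 1 / 2) :
    τ ^ 2 * d ^ 2 ≤ 32 * ((2 * (τ - τ * ε * ρ - 1) * d - τ * ε ^ 2 * ρ * v) ^ 2 / 2
      + ε ^ 2 / 16 * (τ ^ 3 * ρ * v ^ 2)) := by
  have hερ : ε * ρ ≤ 1 / 2 := by nlinarith
  set β : ℝ := τ - τ * ε * ρ - 1 with hβ
  have hβ1 : τ / 4 ≤ β := by nlinarith
  have hβsq : τ ^ 2 / 16 ≤ β ^ 2 := by nlinarith
  have a1 := mul_le_mul_of_nonneg_right hβsq (sq_nonneg d)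
  have a2 : (τ * ε ^ 2 * ρ * v) ^ 2 ≤ ε ^ 2 * (τ ^ 3 * ρ * v ^ 2) / 8 := by
    have b1 : ε ^ 2 * ρ ≤ 1 / 2 := by nlinarith
    have b2 : ε ^ 2 * ρ ≤ τ / 8 := by linarith
    have := mul_le_mul_of_nonneg_left b2 (by positivity : 0 ≤ τ ^ 2 * ε ^ 2 * ρ * v ^ 2)
    linarith
  have a3 : 0 ≤ ε ^ 2 * (τ ^ 3 * ρ * v ^ 2) := by positivity
  clear_value β
  nlinarith only [a1, a2, a3, sq_nonneg (2 * β * d - 2 * (τ * ε ^ 2 * ρ * v))]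

lemma sum_sq_fderiv_le (ε τ : ℝ) {u : EuclideanSpace ℝ (Fin n) → ℝ}
    (hu : Differentiable ℝ u) {x : EuclideanSpace ℝ (Fin n)} (hx : x ≠ 0) :
    carlemanFactor n ε τ x ^ 2 *
        (‖x‖ ^ 2 * ∑ i, fderiv ℝ u x (EuclideanSpace.single i 1) ^ 2) ≤
      2 * (‖x‖ ^ 2 * ∑ i, fderiv ℝ (fun y => carlemanFactor n ε τ y * u y) x
        (EuclideanSpace.single i 1) ^ 2)
      + 2 * (n / 2 - τ + τ * ε * ‖x‖ ^ ε) ^ 2 * (carlemanFactor n ε τ x * u x) ^ 2 := by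
  have hs : ‖x‖ ≠ 0 := by simpa using hx
  set a : ℝ := n / 2 - τ + τ * ε * ‖x‖ ^ ε with ha
  set F := carlemanFactor n ε τ x with hF
  have hi : ∀ i, F ^ 2 * fderiv ℝ u x (EuclideanSpace.single i 1) ^ 2 ≤
      2 * fderiv ℝ (fun y => carlemanFactor n ε τ y * u y) x (EuclideanSpace.single i 1) ^ 2
      + 2 * a ^ 2 * (F * u x) ^ 2 / ‖x‖ ^ 4 * x i ^ 2 := by
    intro i
    rw [fderiv_carlemanFactor_mul ε τ hu hx, inner_single_one, ← ha, ← hF]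
    set p := fderiv ℝ u x (EuclideanSpace.single i 1)
    have h := sq_nonneg (F * p + 2 * (F * (a / ‖x‖ ^ 2 * x i * u x)))
    have h2 : 2 * a ^ 2 * (F * u x) ^ 2 / ‖x‖ ^ 4 * x i ^ 2 =
        2 * (F * (a / ‖x‖ ^ 2 * x i * u x)) ^ 2 := by
      field_simp
    rw [h2]
    linarith
  have hsum := Finset.sum_le_sum fun i (_ : i ∈ Finset.univ) => hi i
  rw [Finset.sum_add_distrib, ← Finset.mul_sum, ← Finset.mul_sum, ← Finset.mul_sum,
    ← EuclideanSpace.real_norm_sq_eq] at hsum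
  have := mul_le_mul_of_nonneg_left hsum (sq_nonneg ‖x‖)
  have h3 : ‖x‖ ^ 2 * (2 * a ^ 2 * (F * u x) ^ 2 / ‖x‖ ^ 4 * ‖x‖ ^ 2) =
      2 * a ^ 2 * (F * u x) ^ 2 := by
    field_simp
  linarith

/-- The Carleman inequality up to divergence terms. -/
lemma carleman_pointwise {ε τ δ N : ℝ} (hε0 : 0 < ε) (hε1 : ε < 1) (hδ : 0 < δ)
    (hτ : (n : ℝ) + 4 ≤ τ) (hN : N ≤ ε ^ 2 * τ ^ 2 / 100)
    {u v W : EuclideanSpace ℝ (Fin n) → ℝ} (hu : ContDiff ℝ 2 u) (hv : ContDiff ℝ 2 v)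
    (huv : v = fun y => carlemanFactor n ε τ y * u y) (hW1 : ContDiff ℝ 1 W)
    {x : EuclideanSpace ℝ (Fin n)} (hx : x ≠ 0) (hδx : δ ≤ ‖x‖) (hρ : ‖x‖ ^ ε ≤ 1 / 2)
    (hs : ‖x‖ ^ 2 ≤ ‖x‖ ^ ε) (hW : |W x| ≤ N) (hD : |fderiv ℝ W x x| ≤ N) :
    τ ^ 3 * (‖x‖ ^ ε * v x ^ 2) + τ ^ 2 * δ ^ 2 * (‖x‖ ^ (-2 : ℝ) * v x ^ 2)
      + τ * (‖x‖ ^ ε * (carlemanFactor n ε τ x ^ 2 *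
        (‖x‖ ^ 2 * ∑ i, fderiv ℝ u x (EuclideanSpace.single i 1) ^ 2))) ≤
    (89 / ε ^ 2 + 17) * (carlemanFactor n ε τ x * (‖x‖ ^ 2 * (eLap u x + W x * u x))) ^ 2
      - (178 / ε ^ 2 + 32) * (carlemanMultiplier ε τ v x *
          (‖x‖ ^ 2 * eLap v x - (n - 2) * fderiv ℝ v x x)
        + ‖x‖ ^ 2 * ∑ i, fderiv ℝ v x (EuclideanSpace.single i 1) *
          fderiv ℝ (carlemanMultiplier ε τ v) x (EuclideanSpace.single i 1))
      - (178 / ε ^ 2 + 32) * fderiv ℝ (carlemanFlux ε τ v W) x x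
      + 2 * τ * (‖x‖ ^ ε * v x * (‖x‖ ^ 2 * eLap v x - (n - 2) * fderiv ℝ v x x)
        + ‖x‖ ^ 2 * ∑ i, fderiv ℝ v x (EuclideanSpace.single i 1) *
          fderiv ℝ (fun y => ‖y‖ ^ ε * v y) x (EuclideanSpace.single i 1))
      - τ ^ 2 * δ ^ 2 * fderiv ℝ (fun y => ‖y‖ ^ (-2 : ℝ) * v y ^ 2) x x := by
  have hr : 0 < ‖x‖ := norm_pos_iff.2 hx
  have hn0 : (0 : ℝ) ≤ n := Nat.cast_nonneg n
  have hτ4 : 4 ≤ τ := by linarith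
  have hgrad := sum_sq_fderiv_le (n := n) ε τ (hu.differentiable two_ne_zero) hx
  have hconj := carlemanFactor_mul_eLap (n := n) ε τ hu hx
  rw [sum_fderiv_mul_fderiv_carlemanMultiplier ε τ hv hx,
    sum_fderiv_mul_fderiv_norm_rpow_mul ε hv hx, fderiv_carlemanFlux_self ε τ hv hW1 hx,
    fderiv_norm_rpow_mul_sq_self (-2) hv hx]
  rw [← huv] at hgrad hconj
  have hvx : carlemanFactor n ε τ x * u x = v x := by rw [huv]
  rw [hvx] at hgrad hconj
  have hinv : ‖x‖ ^ (-2 : ℝ) * δ ^ 2 ≤ 1 := by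
    rw [Real.rpow_neg hr.le, inv_mul_le_iff₀ (by positivity)]
    norm_cast
    nlinarith
  have hinv0 : 0 ≤ ‖x‖ ^ (-2 : ℝ) := by positivity
  simp only [carlemanMultiplier]
  set f := carlemanFactor n ε τ x * (‖x‖ ^ 2 * (eLap u x + W x * u x)) with hf
  set l := ‖x‖ ^ 2 * eLap v x - (n - 2) * fderiv ℝ v x x
  have hf' : f = l + 2 * (τ - τ * ε * ‖x‖ ^ ε - 1) * fderiv ℝ v x x
      + ((τ - τ * ε * ‖x‖ ^ ε - 1) ^ 2 - (((n : ℝ) - 2) / 2) ^ 2 - τ * ε ^ 2 * ‖x‖ ^ ε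
        + ‖x‖ ^ 2 * W x) * v x := by
    have : f = carlemanFactor n ε τ x * (‖x‖ ^ 2 * eLap u x) + ‖x‖ ^ 2 * W x * v x := by
      rw [hf, ← hvx]; ring
    rw [this, hconj]; ring
  set g := ‖x‖ ^ 2 * ∑ i, fderiv ℝ v x (EuclideanSpace.single i 1) ^ 2
  set q := ‖x‖ ^ 2 * ∑ i, fderiv ℝ v x (EuclideanSpace.single i 1) *
          fderiv ℝ (fderiv ℝ v) x x (EuclideanSpace.single i 1)
  set gu := carlemanFactor n ε τ x ^ 2 *
        (‖x‖ ^ 2 * ∑ i, fderiv ℝ u x (EuclideanSpace.single i 1) ^ 2)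
  set d := fderiv ℝ v x x
  have hρ0 : 0 ≤ ‖x‖ ^ ε := by positivity
  set ρ := ‖x‖ ^ ε
  set k := ‖x‖ ^ (-2 : ℝ)
  have I1 := commutator_lower_bound (g := g) (q := q) hε0 hε1 hτ4 hρ0 hρ (sq_nonneg ‖x‖) hs hW hD
    hN hf'
  have I3 := angular_upper_bound (g := g) hε0 hε1 hτ4 hρ0 hρ (sq_nonneg ‖x‖) hs hW hN hf'
  have I2 := radial_upper_bound (v := v x) (d := d) hε0 hε1 hτ4 hρ0 hρ
  have hερ0 : 0 ≤ ε * ρ := by positivity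
  have hερ : ε * ρ ≤ 1 / 2 := by linarith only [mul_le_mul hε1.le hρ hρ0 zero_le_one]
  have ha : ((n : ℝ) / 2 - τ + τ * ε * ρ) ^ 2 ≤ τ ^ 2 := by
    have : 0 ≤ τ * (ε * ρ) := by positivity
    apply sq_le_sq'
    · linarith only [this, hn0]
    · have := mul_le_mul_of_nonneg_left hερ (by linarith only [hτ4] : 0 ≤ τ)
      linarith only [this, hn0, hτ]
  have I4 : τ * (ρ * gu) ≤ 2 * (τ * ρ * g) + 2 * (τ ^ 3 * ρ * v x ^ 2) := by
    have a1 := mul_le_mul_of_nonneg_left hgrad (by positivity : 0 ≤ τ * ρ)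
    have a2 := mul_le_mul_of_nonneg_left ha (by positivity : 0 ≤ 2 * (τ * ρ * v x ^ 2))
    linarith only [a1, a2]
  have I5 : τ ^ 2 * δ ^ 2 * (k * v x ^ 2) ≤ τ ^ 2 * d ^ 2
      - τ ^ 2 * δ ^ 2 * (-2 * k * v x ^ 2 + 2 * k * v x * d) := by
    have a1 := mul_nonneg (sq_nonneg τ) (mul_nonneg (sub_nonneg.2 hinv) (sq_nonneg d))
    have a2 := mul_nonneg (sq_nonneg τ) (mul_nonneg (mul_nonneg hinv0 (sq_nonneg δ))
      (sq_nonneg (v x - d)))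
    linarith only [a1, a2]
  set A := (2 * (τ - τ * ε * ρ - 1) * d - τ * ε ^ 2 * ρ * v x) ^ 2 / 2
  have hA : 0 ≤ A := by positivity
  have I6 : 11 * (τ ^ 3 * ρ * v x ^ 2) + 4 * (τ * ρ * d ^ 2) + τ ^ 2 * d ^ 2 ≤
      (178 / ε ^ 2 + 32) * (A + 2 * (τ * ε ^ 2 * ρ * d ^ 2)
        + ε ^ 2 / 16 * (τ ^ 3 * ρ * v x ^ 2)) := by
    have b1 : (178 / ε ^ 2 + 32) * (A + 2 * (τ * ε ^ 2 * ρ * d ^ 2)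
        + ε ^ 2 / 16 * (τ ^ 3 * ρ * v x ^ 2)) = 178 / ε ^ 2 * A + 356 * (τ * ρ * d ^ 2)
        + 178 / 16 * (τ ^ 3 * ρ * v x ^ 2) + 32 * (A + ε ^ 2 / 16 * (τ ^ 3 * ρ * v x ^ 2))
        + 64 * (τ * ε ^ 2 * ρ * d ^ 2) := by
      field_simp
      ring
    have b2 : 0 ≤ 178 / ε ^ 2 * A := by positivity
    have b3 : 0 ≤ τ * ρ * d ^ 2 := by positivity
    have b4 : 0 ≤ τ ^ 3 * ρ * v x ^ 2 := by positivity
    have b5 : 0 ≤ τ * ε ^ 2 * ρ * d ^ 2 := by positivity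
    linarith only [I2, b1, b2, b3, b4, b5]
  have I7 := mul_le_mul_of_nonneg_left I1 (by positivity : 0 ≤ 178 / ε ^ 2 + 32)
  have hk1 : 89 / ε ^ 2 + 17 = (178 / ε ^ 2 + 32) / 2 + 1 := by ring
  rw [hk1]
  set κ := 178 / ε ^ 2 + 32
  linarith only [I3, I4, I5, I6, I7]

end Pointwise

section Integrated

variable {n : ℕ}

lemma continuous_eLap {u : EuclideanSpace ℝ (Fin n) → ℝ} (hu : ContDiff ℝ (⊤ : ℕ∞) u) :
    Continuous (eLap u) := by
  refine continuous_finsetSum _ fun i _ => ?_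
  have h1 : ContDiff ℝ 1 fun y => fderiv ℝ u y (EuclideanSpace.single i 1) :=
    (hu.fderiv_right (m := 1) (by norm_cast)).clm_apply contDiff_const
  exact (h1.continuous_fderiv one_ne_zero).clm_apply continuous_const

lemma eLap_eq_zero_of_vanish {K : Set (EuclideanSpace ℝ (Fin n))} (hK : IsClosed K)
    {u : EuclideanSpace ℝ (Fin n) → ℝ} (hu : ∀ x ∉ K, u x = 0)
    {x : EuclideanSpace ℝ (Fin n)} (hx : x ∉ K) : eLap u x = 0 := by
  refine Finset.sum_eq_zero fun i _ => ?_
  rw [fderiv_eq_zero_of_vanish hK (fun y hy => ?_) hx]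
  · simp
  · rw [fderiv_eq_zero_of_vanish hK hu hy]
    simp

lemma abs_le_eC1Norm {W : EuclideanSpace ℝ (Fin n) → ℝ} (hW : ContDiff ℝ 1 W) {R : ℝ}
    {x : EuclideanSpace ℝ (Fin n)} (hx : x ∈ ball (0 : EuclideanSpace ℝ (Fin n)) R) :
    |W x| ≤ eC1Norm W R ∧ ‖fderiv ℝ W x‖ ≤ eC1Norm W R := by
  have hg : ∀ y, ‖gradient W y‖ = ‖fderiv ℝ W y‖ := fun y => by simp [gradient]
  have hbdd : ∀ f : EuclideanSpace ℝ (Fin n) → ℝ, Continuous f →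
      BddAbove (f '' ball (0 : EuclideanSpace ℝ (Fin n)) R) := fun f hf =>
    ((isCompact_closedBall (0 : EuclideanSpace ℝ (Fin n)) R).bddAbove_image hf.continuousOn).mono
      (Set.image_mono ball_subset_closedBall)
  have h1 := le_csSup (hbdd (fun x => |W x|) hW.continuous.abs) (Set.mem_image_of_mem _ hx)
  have h2 := le_csSup (hbdd (fun x => ‖gradient W x‖) (by
    simp_rw [hg]
    exact (hW.continuous_fderiv one_ne_zero).norm)) (Set.mem_image_of_mem _ hx)
  simp only [hg] at h2
  rw [eC1Norm]
  simp only [hg]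
  constructor <;> linarith [abs_nonneg (W x), norm_nonneg (fderiv ℝ W x)]

lemma carlemanFactor_sq (ε τ : ℝ) {x : EuclideanSpace ℝ (Fin n)} (hx : x ≠ 0) :
    Real.exp (τ * (-Real.log ‖x‖ + ‖x‖ ^ ε)) ^ 2 =
      ‖x‖ ^ (-(n : ℝ)) * carlemanFactor n ε τ x ^ 2 := by
  have hr : 0 < ‖x‖ := norm_pos_iff.2 hx
  have h1 : Real.exp (τ * (-Real.log ‖x‖ + ‖x‖ ^ ε)) =
      ‖x‖ ^ (-τ) * Real.exp (τ * ‖x‖ ^ ε) := by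
    rw [Real.rpow_def_of_pos hr (-τ), ← Real.exp_add]
    congr 1
    ring
  have h2 : ‖x‖ ^ (-(n : ℝ)) * (‖x‖ ^ ((n : ℝ) / 2 - τ)) ^ 2 = (‖x‖ ^ (-τ)) ^ 2 := by
    rw [← Real.rpow_natCast, ← Real.rpow_natCast, ← Real.rpow_mul hr.le, ← Real.rpow_mul hr.le,
      ← Real.rpow_add hr]
    congr 1
    push_cast
    ring
  rw [h1, carlemanFactor, mul_pow, mul_pow, ← h2]
  ring

/-- The integrated Carleman inequality, in terms of squared weighted norms. -/
lemma carleman_integrated {ε τ δ N : ℝ} (hε0 : 0 < ε) (hε1 : ε < 1) (hδ : 0 < δ)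
    (hτ : (n : ℝ) + 4 ≤ τ) (hN : N ≤ ε ^ 2 * τ ^ 2 / 100)
    {u W : EuclideanSpace ℝ (Fin n) → ℝ} (hu : ContDiff ℝ (⊤ : ℕ∞) u) (hW1 : ContDiff ℝ 1 W)
    {K : Set (EuclideanSpace ℝ (Fin n))} (hK : IsCompact K) (h0 : 0 ∉ K)
    (huK : ∀ x ∉ K, u x = 0) (hδK : ∀ x ∈ K, δ ≤ ‖x‖) (hρK : ∀ x ∈ K, ‖x‖ ^ ε ≤ 1 / 2)
    (hsK : ∀ x ∈ K, ‖x‖ ^ 2 ≤ ‖x‖ ^ ε) (hWK : ∀ x ∈ K, |W x| ≤ N)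
    (hDK : ∀ x ∈ K, |fderiv ℝ W x x| ≤ N) :
    τ ^ 3 * (∫ x : EuclideanSpace ℝ (Fin n),
        (‖x‖ ^ (ε / 2) * Real.exp (τ * (-Real.log ‖x‖ + ‖x‖ ^ ε)) * u x) ^ 2) +
      τ ^ 2 * δ ^ 2 * (∫ x : EuclideanSpace ℝ (Fin n),
        (‖x‖ ^ (-1 : ℝ) * Real.exp (τ * (-Real.log ‖x‖ + ‖x‖ ^ ε)) * u x) ^ 2) +
      τ * (∫ x : EuclideanSpace ℝ (Fin n),
        (‖x‖ ^ (1 + ε / 2) * Real.exp (τ * (-Real.log ‖x‖ + ‖x‖ ^ ε)) * ‖gradient u x‖) ^ 2) ≤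
    (89 / ε ^ 2 + 17) * ∫ x : EuclideanSpace ℝ (Fin n),
        (‖x‖ ^ (2 : ℝ) * Real.exp (τ * (-Real.log ‖x‖ + ‖x‖ ^ ε)) *
          (eLap u x + W x * u x)) ^ 2 := by
  have hKne : ∀ x ∈ K, x ≠ 0 := fun x hx h => h0 (h ▸ hx)
  obtain ⟨v, hvdef⟩ : ∃ v : EuclideanSpace ℝ (Fin n) → ℝ,
      v = fun y => carlemanFactor n ε τ y * u y := ⟨_, rfl⟩
  have hu2 : ContDiff ℝ 2 u := hu.of_le (by norm_cast)
  have hvK : ∀ x ∉ K, v x = 0 := fun x hx => by rw [hvdef]; simp [huK x hx]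
  have hv : ContDiff ℝ 2 v := by
    refine contDiff_of_vanish hK.isClosed h0 (fun x hx => ?_) hvK
    rw [hvdef]
    exact (contDiffAt_carlemanFactor ε τ hx).mul hu2.contDiffAt
  have hfv1 : ContDiff ℝ 1 (fderiv ℝ v) := hv.fderiv_right (by norm_num)
  have hDv1 : ContDiff ℝ 1 fun x => fderiv ℝ v x x := hfv1.clm_apply contDiff_id
  have hv1 : ContDiff ℝ 1 v := hv.of_le (by norm_num)
  have hfvK : ∀ x ∉ K, fderiv ℝ v x = 0 := fun x hx =>
    fderiv_eq_zero_of_vanish hK.isClosed hvK hx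
  have hfuK : ∀ x ∉ K, fderiv ℝ u x = 0 := fun x hx =>
    fderiv_eq_zero_of_vanish hK.isClosed huK hx
  have hw1K : ∀ x ∉ K, carlemanMultiplier ε τ v x = 0 := fun x hx => by
    simp [carlemanMultiplier, hvK x hx, hfvK x hx]
  have hw1 : ContDiff ℝ 1 (carlemanMultiplier ε τ v) := by
    refine contDiff_of_vanish hK.isClosed h0 (fun x hx => ?_) hw1K
    have hρ := contDiffAt_norm_rpow_of_ne (m := 1) ε hx
    exact ((contDiffAt_const.mul ((contDiffAt_const.sub (contDiffAt_const.mul hρ)).sub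
      contDiffAt_const)).mul hDv1.contDiffAt).sub ((contDiffAt_const.mul hρ).mul hv1.contDiffAt)
  have hw2K : ∀ x ∉ K, ‖x‖ ^ ε * v x = 0 := fun x hx => by simp [hvK x hx]
  have hw2 : ContDiff ℝ 1 fun x => ‖x‖ ^ ε * v x :=
    contDiff_of_vanish hK.isClosed h0
      (fun x hx => (contDiffAt_norm_rpow_of_ne ε hx).mul hv1.contDiffAt) hw2K
  have hG1 : ∀ x ≠ 0, ContDiffAt ℝ 1 (carlemanFlux ε τ v W) x := fun x hx => by
    have hρ := contDiffAt_norm_rpow_of_ne (m := 1) ε hx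
    have hβ : ContDiffAt ℝ 1 (fun x : EuclideanSpace ℝ (Fin n) => τ - τ * ε * ‖x‖ ^ ε - 1) x :=
      (contDiffAt_const.sub (contDiffAt_const.mul hρ)).sub contDiffAt_const
    have hs : ContDiffAt ℝ 1 (fun x : EuclideanSpace ℝ (Fin n) => ‖x‖ ^ 2) x :=
      (contDiff_norm_sq ℝ).contDiffAt
    have hP : ContDiffAt ℝ 1 (fun x => ∑ i, fderiv ℝ v x (EuclideanSpace.single i 1) ^ 2) x :=
      ContDiffAt.sum fun i _ => ((hfv1.clm_apply contDiff_const).contDiffAt).pow 2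
    exact (hβ.mul (((((hβ.pow 2).sub contDiffAt_const).add (hs.mul hW1.contDiffAt)).mul
      (hv1.contDiffAt.pow 2)).sub (hs.mul hP))).add
      ((contDiffAt_const.mul hρ).mul (hv1.contDiffAt.pow 2))
  have hG1K : ∀ x ∉ K, carlemanFlux ε τ v W x = 0 := fun x hx => by
    simp [carlemanFlux, hvK x hx, hfvK x hx]
  have hG2 : ∀ x ≠ 0, ContDiffAt ℝ 1 (fun y => ‖y‖ ^ (-2 : ℝ) * v y ^ 2) x := fun x hx =>
    (contDiffAt_norm_rpow_of_ne (-2) hx).mul (hv1.contDiffAt.pow 2)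
  have hG2K : ∀ x ∉ K, ‖x‖ ^ (-2 : ℝ) * v x ^ 2 = 0 := fun x hx => by simp [hvK x hx]
  obtain ⟨iB1, zB1⟩ := integral_green_eq_zero hK h0 hv hw1 hw1K
  obtain ⟨iB2, zB2⟩ := integral_green_eq_zero hK h0 hv hw2 hw2K
  obtain ⟨iD1, zD1⟩ := integral_euler_eq_zero hK h0 hG1 hG1K
  obtain ⟨iD2, zD2⟩ := integral_euler_eq_zero hK h0 hG2 hG2K
  have hexp : ∀ x ≠ 0, ContinuousAt (fun x : EuclideanSpace ℝ (Fin n) =>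
      Real.exp (τ * (-Real.log ‖x‖ + ‖x‖ ^ ε))) x := fun x hx => by
    have hr : ‖x‖ ≠ 0 := by simpa using hx
    exact (((continuousAt_id.norm.log hr).neg.add
      (continuousAt_id.norm.rpow_const (Or.inl hr))).const_mul τ).rexp
  have hpow : ∀ p : ℝ, ∀ x ≠ 0, ContinuousAt (fun x : EuclideanSpace ℝ (Fin n) => ‖x‖ ^ p) x :=
    fun p x hx => (contDiffAt_norm_rpow_of_ne (m := 0) p hx).continuousAt
  have hgn : ∀ y, ‖gradient u y‖ = ‖fderiv ℝ u y‖ := fun y => by simp [gradient]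
  have i1 : Integrable fun x : EuclideanSpace ℝ (Fin n) =>
      (‖x‖ ^ (ε / 2) * Real.exp (τ * (-Real.log ‖x‖ + ‖x‖ ^ ε)) * u x) ^ 2 :=
    integrable_of_vanish hK h0 (fun x hx => (((hpow _ x hx).mul (hexp x hx)).mul
      hu.continuous.continuousAt).pow 2) (fun x hx => by simp [huK x hx])
  have i2 : Integrable fun x : EuclideanSpace ℝ (Fin n) =>
      (‖x‖ ^ (-1 : ℝ) * Real.exp (τ * (-Real.log ‖x‖ + ‖x‖ ^ ε)) * u x) ^ 2 :=
    integrable_of_vanish hK h0 (fun x hx => (((hpow _ x hx).mul (hexp x hx)).mul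
      hu.continuous.continuousAt).pow 2) (fun x hx => by simp [huK x hx])
  have i3 : Integrable fun x : EuclideanSpace ℝ (Fin n) =>
      (‖x‖ ^ (1 + ε / 2) * Real.exp (τ * (-Real.log ‖x‖ + ‖x‖ ^ ε)) * ‖gradient u x‖) ^ 2 := by
    simp_rw [hgn]
    exact integrable_of_vanish hK h0 (fun x hx => (((hpow _ x hx).mul (hexp x hx)).mul
      (hu2.continuous_fderiv two_ne_zero).norm.continuousAt).pow 2)
      (fun x hx => by simp [hfuK x hx])
  have i4 : Integrable fun x : EuclideanSpace ℝ (Fin n) =>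
      (‖x‖ ^ (2 : ℝ) * Real.exp (τ * (-Real.log ‖x‖ + ‖x‖ ^ ε)) *
          (eLap u x + W x * u x)) ^ 2 :=
    integrable_of_vanish hK h0 (fun x hx => (((hpow _ x hx).mul (hexp x hx)).mul
      ((continuous_eLap hu).add (hW1.continuous.mul hu.continuous)).continuousAt).pow 2)
      (fun x hx => by simp [huK x hx, eLap_eq_zero_of_vanish hK.isClosed huK hx])
  have hint := integral_mono
    (((i1.const_mul (τ ^ 3)).add (i2.const_mul (τ ^ 2 * δ ^ 2))).add (i3.const_mul τ))
    (((((i4.const_mul (89 / ε ^ 2 + 17)).sub (iB1.const_mul (178 / ε ^ 2 + 32))).sub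
      (iD1.const_mul (178 / ε ^ 2 + 32))).add (iB2.const_mul (2 * τ))).sub
      (iD2.const_mul (τ ^ 2 * δ ^ 2))) (fun x => ?_)
  · rw [integral_add' ((i1.const_mul _).add (i2.const_mul _)) (i3.const_mul _),
      integral_add' (i1.const_mul _) (i2.const_mul _),
      integral_sub' ((((i4.const_mul _).sub (iB1.const_mul _)).sub (iD1.const_mul _)).add
        (iB2.const_mul _)) (iD2.const_mul _),
      integral_add' (((i4.const_mul _).sub (iB1.const_mul _)).sub (iD1.const_mul _))
        (iB2.const_mul _),
      integral_sub' ((i4.const_mul _).sub (iB1.const_mul _)) (iD1.const_mul _),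
      integral_sub' (i4.const_mul _) (iB1.const_mul _)] at hint
    simp only [integral_const_mul, zB1, zB2, zD1, zD2, mul_zero, sub_zero, add_zero] at hint
    exact hint
  · simp only [Pi.add_apply, Pi.sub_apply]
    by_cases hxK : x ∈ K
    · have hx := hKne x hxK
      have hr : 0 < ‖x‖ := norm_pos_iff.2 hx
      have hpt := carleman_pointwise hε0 hε1 hδ hτ hN hu2 hv hvdef hW1 hx (hδK x hxK)
        (hρK x hxK) (hsK x hxK) (hWK x hxK) (hDK x hxK)
      have hM : 0 ≤ ‖x‖ ^ (-(n : ℝ)) := by positivity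
      have hpt := mul_le_mul_of_nonneg_left hpt hM
      have p1 : (‖x‖ ^ (ε / 2)) ^ 2 = ‖x‖ ^ ε := by
        rw [← Real.rpow_natCast, ← Real.rpow_mul hr.le]
        congr 1
        push_cast
        ring
      have p2 : (‖x‖ ^ (-1 : ℝ)) ^ 2 = ‖x‖ ^ (-2 : ℝ) := by
        rw [← Real.rpow_natCast, ← Real.rpow_mul hr.le]
        norm_num
      have p3 : (‖x‖ ^ (1 + ε / 2)) ^ 2 = ‖x‖ ^ 2 * ‖x‖ ^ ε := by
        rw [Real.rpow_add hr, Real.rpow_one, mul_pow, p1]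
      have p4 : ‖x‖ ^ (2 : ℝ) = ‖x‖ ^ 2 := by norm_cast
      have hvx : v x = carlemanFactor n ε τ x * u x := by rw [hvdef]
      simp only [mul_pow, p1, p2, p3, p4, carlemanFactor_sq ε τ hx, norm_gradient_sq] at hpt ⊢
      rw [hvx] at hpt
      rw [hvx]
      linarith only [hpt]
    · have hgx : ‖gradient u x‖ = 0 := by rw [hgn, hfuK x hxK, norm_zero]
      rw [hgx, fderiv_eq_zero_of_vanish hK.isClosed hG2K hxK]
      simp [huK x hxK, hvK x hxK, hfvK x hxK, hw1K x hxK,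
        eLap_eq_zero_of_vanish hK.isClosed huK hxK,
        fderiv_eq_zero_of_vanish hK.isClosed hG1K hxK]

end Integrated

/-- Carleman estimate for `Δ + W` with weight `φ(x) = -log|x| + |x|^ε`, for functions
supported in `{|x| ≥ δ}`, with the extra term `τ δ ‖r⁻¹ e^{τφ} u‖`
(Euclidean-metric case of the second inequality of Theorem 2.1). -/
theorem carleman_estimate_scalar_away_from_origin (n : ℕ) (hn : 2 ≤ n)
    (ε : ℝ) (hε0 : 0 < ε) (hε1 : ε < 1) :
    ∃ R₀ C C₁ C₂ : ℝ, 0 < R₀ ∧ 0 < C ∧ 0 < C₁ ∧ 0 < C₂ ∧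
      ∀ W : EuclideanSpace ℝ (Fin n) → ℝ, ContDiff ℝ 1 W →
      ∀ δ : ℝ, 0 < δ →
      ∀ u : EuclideanSpace ℝ (Fin n) → ℝ, ContDiff ℝ (⊤ : ℕ∞) u → HasCompactSupport u →
        tsupport u ⊆ ball (0 : EuclideanSpace ℝ (Fin n)) R₀ \ {0} →
        tsupport u ⊆ {x : EuclideanSpace ℝ (Fin n) | δ ≤ ‖x‖} →
      ∀ τ : ℝ, C₁ * Real.sqrt (eC1Norm W R₀) + C₂ ≤ τ →
        τ ^ ((3 : ℝ) / 2) *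
            eL2 (fun x => ‖x‖ ^ (ε / 2) * Real.exp (τ * (-Real.log ‖x‖ + ‖x‖ ^ ε)) * u x) +
          τ * δ *
            eL2 (fun x => ‖x‖ ^ (-1 : ℝ) * Real.exp (τ * (-Real.log ‖x‖ + ‖x‖ ^ ε)) * u x) +
          τ ^ ((1 : ℝ) / 2) *
            eL2 (fun x => ‖x‖ ^ (1 + ε / 2) * Real.exp (τ * (-Real.log ‖x‖ + ‖x‖ ^ ε)) *
              ‖gradient u x‖) ≤
        C * eL2 (fun x => ‖x‖ ^ (2 : ℝ) * Real.exp (τ * (-Real.log ‖x‖ + ‖x‖ ^ ε)) *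
          (eLap u x + W x * u x)) := by
  obtain ⟨R₀, hR0, hR1, hRε⟩ : ∃ R₀ : ℝ, 0 < R₀ ∧ R₀ ≤ 1 ∧ R₀ ^ ε = 1 / 2 := by
    refine ⟨(1 / 2) ^ (1 / ε), by positivity, Real.rpow_le_one (by norm_num) (by norm_num)
      (by positivity), ?_⟩
    rw [← Real.rpow_mul (by norm_num), one_div_mul_cancel hε0.ne', Real.rpow_one]
  refine ⟨R₀, 3 * √(89 / ε ^ 2 + 17), 10 / ε, n + 4, hR0, by positivity, by positivity,
    by positivity, ?_⟩
  intro W hW δ hδ u hu huc hsupp hsuppδ τ hτ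
  have hC0 : 0 ≤ 10 / ε * √(eC1Norm W R₀) := by positivity
  have hτn : (n : ℝ) + 4 ≤ τ := by linarith
  have hn0 : (0 : ℝ) ≤ n := Nat.cast_nonneg n
  have hτ0 : 0 < τ := by linarith
  have hN : eC1Norm W R₀ ≤ ε ^ 2 * τ ^ 2 / 100 := by
    have h1 : √(eC1Norm W R₀) ≤ ε * τ / 10 := by
      have h2 : 10 / ε * √(eC1Norm W R₀) ≤ τ := by linarith
      rw [div_mul_eq_mul_div, div_le_iff₀ hε0] at h2
      linarith
    have h3 := (Real.sqrt_le_left (by positivity)).1 h1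
    linarith
  have hKx : ∀ x ∈ tsupport u, x ≠ 0 ∧ ‖x‖ < R₀ := fun x hx =>
    ⟨(hsupp hx).2, by simpa using (hsupp hx).1⟩
  have main := carleman_integrated hε0 hε1 hδ hτn hN hu hW huc (fun h => (hsupp h).2 rfl)
    (fun x hx => image_eq_zero_of_notMem_tsupport hx) (fun x hx => hsuppδ hx)
    (fun x hx => hRε ▸ Real.rpow_le_rpow (norm_nonneg _) (hKx x hx).2.le hε0.le)
    (fun x hx => by
      rw [← Real.rpow_natCast]
      exact Real.rpow_le_rpow_of_exponent_ge (norm_pos_iff.2 (hKx x hx).1)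
        ((hKx x hx).2.le.trans hR1) (by push_cast; linarith))
    (fun x hx => (abs_le_eC1Norm hW (hsupp hx).1).1)
    (fun x hx => by
      have h1 := (abs_le_eC1Norm hW (hsupp hx).1).2
      have h2 := (fderiv ℝ W x).le_opNorm x
      rw [Real.norm_eq_abs] at h2
      exact h2.trans ((mul_le_of_le_one_right (norm_nonneg _)
        ((hKx x hx).2.le.trans hR1)).trans h1))
  simp only [eL2]
  set I₁ := ∫ x : EuclideanSpace ℝ (Fin n),
    (‖x‖ ^ (ε / 2) * Real.exp (τ * (-Real.log ‖x‖ + ‖x‖ ^ ε)) * u x) ^ 2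
  set I₂ := ∫ x : EuclideanSpace ℝ (Fin n),
    (‖x‖ ^ (-1 : ℝ) * Real.exp (τ * (-Real.log ‖x‖ + ‖x‖ ^ ε)) * u x) ^ 2
  set I₃ := ∫ x : EuclideanSpace ℝ (Fin n),
    (‖x‖ ^ (1 + ε / 2) * Real.exp (τ * (-Real.log ‖x‖ + ‖x‖ ^ ε)) * ‖gradient u x‖) ^ 2
  set I₄ := ∫ x : EuclideanSpace ℝ (Fin n),
    (‖x‖ ^ (2 : ℝ) * Real.exp (τ * (-Real.log ‖x‖ + ‖x‖ ^ ε)) * (eLap u x + W x * u x)) ^ 2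
  have n1 : 0 ≤ τ ^ 3 * I₁ := mul_nonneg (by positivity) (integral_nonneg fun x => sq_nonneg _)
  have n2 : 0 ≤ τ ^ 2 * δ ^ 2 * I₂ :=
    mul_nonneg (by positivity) (integral_nonneg fun x => sq_nonneg _)
  have n3 : 0 ≤ τ * I₃ := mul_nonneg hτ0.le (integral_nonneg fun x => sq_nonneg _)
  have t1 : τ ^ ((3 : ℝ) / 2) * √I₁ = √(τ ^ 3 * I₁) := by
    rw [Real.sqrt_mul (by positivity), Real.sqrt_eq_rpow (τ ^ 3), ← Real.rpow_natCast,
      ← Real.rpow_mul hτ0.le]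
    norm_num
  have t2 : τ * δ * √I₂ = √(τ ^ 2 * δ ^ 2 * I₂) := by
    rw [Real.sqrt_mul (by positivity), ← mul_pow, Real.sqrt_sq (by positivity)]
  have t3 : τ ^ ((1 : ℝ) / 2) * √I₃ = √(τ * I₃) := by
    rw [Real.sqrt_mul hτ0.le, Real.sqrt_eq_rpow τ]
  rw [t1, t2, t3, mul_assoc 3, ← Real.sqrt_mul (by positivity)]
  have s1 := Real.sqrt_le_sqrt (by linarith : τ ^ 3 * I₁ ≤ (89 / ε ^ 2 + 17) * I₄)
  have s2 := Real.sqrt_le_sqrt (by linarith : τ ^ 2 * δ ^ 2 * I₂ ≤ (89 / ε ^ 2 + 17) * I₄)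
  have s3 := Real.sqrt_le_sqrt (by linarith : τ * I₃ ≤ (89 / ε ^ 2 + 17) * I₄)
  linarith
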